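/- Let p be an odd prime, f ≥ 0 an integer, d = p^f + 1, and let F_q be a finite field of characteristic p containing a primitive d-th root of unity ζ. Then for every i ∈ ℤ/dℤ, the point P_i = (ζ^i u, ζ^i u (ζ^i u + 1)^{d/2}) is a rational point of the Weierstrass curve y² = x(x+1)(x+u^d) over the rational function field F_q(u). -/

import Mathlib

/-- If `c ^ (q + 1) = 1` with `q` a power of the odd characteristic, then `x = c u` is the abscissa
of a nonsingular point of `y² = x (x + 1) (x + u ^ (q + 1))`. -/
theorem nonsingular_legendre_of_pow_eq_one {K : Type*} [Field K] (p : ℕ) (hp : p.Prime)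
    (hodd : Odd p) [CharP K p] (f : ℕ) (c u : K) (hc : c ^ (p ^ f + 1) = 1) (hu : u ≠ 0)
    (hcu : c * u + 1 ≠ 0) :
    WeierstrassCurve.Affine.Nonsingular
      ({ a₁ := 0, a₂ := u ^ (p ^ f + 1) + 1, a₃ := 0, a₄ := u ^ (p ^ f + 1), a₆ := 0 } :
        WeierstrassCurve.Affine K)
      (c * u) (c * u * (c * u + 1) ^ ((p ^ f + 1) / 2)) := by
  have : Fact p.Prime := ⟨hp⟩
  have hc0 : c ≠ 0 := by
    rintro rfl
    simp at hc
  have h2 : (2 : K) ≠ 0 := by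
    apply Ring.two_ne_zero
    rw [ringChar.eq K p]
    rintro rfl
    exact absurd hodd (by decide)
  have heven : (p ^ f + 1) / 2 * 2 = p ^ f + 1 :=
    Nat.div_mul_cancel (hodd.pow.add_one).two_dvd
  have hfrob : (c * u + 1) ^ (p ^ f) = c ^ (p ^ f) * u ^ (p ^ f) + 1 := by
    rw [add_pow_char_pow, one_pow, mul_pow]
  have hsq : ((c * u + 1) ^ ((p ^ f + 1) / 2)) ^ 2
      = (c ^ (p ^ f) * u ^ (p ^ f) + 1) * (c * u + 1) := by
    rw [← pow_mul, heven, pow_succ, hfrob]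
  rw [WeierstrassCurve.Affine.nonsingular_iff, WeierstrassCurve.Affine.equation_iff]
  refine ⟨?_, Or.inr ?_⟩
  · simp only [zero_mul, add_zero]
    rw [mul_pow, hsq]
    rw [pow_succ] at hc ⊢
    linear_combination (c * u + 1) * c * u ^ 2 * u ^ (p ^ f) * hc
  · have hy : c * u * (c * u + 1) ^ ((p ^ f + 1) / 2) ≠ 0 :=
      mul_ne_zero (mul_ne_zero hc0 hu) (pow_ne_zero _ hcu)
    simp only [zero_mul, sub_zero]
    intro h
    exact mul_ne_zero h2 hy (by linear_combination h)

theorem RatFunc.C_mul_X_add_one_ne_zero {F : Type*} [Field F] (a : F) :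
    RatFunc.C a * RatFunc.X + 1 ≠ 0 := by
  have h : algebraMap (Polynomial F) (RatFunc F) (Polynomial.C a * Polynomial.X + 1) ≠ 0 := by
    apply RatFunc.algebraMap_ne_zero
    intro h0
    simpa using congrArg (Polynomial.eval 0) h0
  simpa using h

/-- Let `p` be an odd prime, `f ≥ 0`, `d = p^f + 1`, and let `F` be a finite
field of characteristic `p` containing a primitive `d`-th root of unity `ζ`.  Then for every
`i ∈ ℤ/dℤ`, the point `P_i = (ζ^i u, ζ^i u (ζ^i u + 1)^{d/2})` is a rational point of the
Weierstrass curve `y² = x(x+1)(x+u^d)` over the rational function field `F(u)`. -/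
theorem legendre_explicit_points
    (p : ℕ) (hp : p.Prime) (hodd : Odd p) (f d : ℕ) (hd : d = p ^ f + 1)
    (F : Type) [Field F] [Fintype F] [CharP F p]
    (ζ : F) (hζ : IsPrimitiveRoot ζ d) (i : ZMod d) :
    let u : RatFunc F := RatFunc.X
    let W : WeierstrassCurve.Affine (RatFunc F) :=
      { a₁ := 0, a₂ := u ^ d + 1, a₃ := 0, a₄ := u ^ d, a₆ := 0 }
    W.Nonsingular (RatFunc.C ζ ^ i.val * u)
      (RatFunc.C ζ ^ i.val * u * (RatFunc.C ζ ^ i.val * u + 1) ^ (d / 2)) := by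
  subst hd
  have : CharP (RatFunc F) p := charP_of_injective_algebraMap (algebraMap F (RatFunc F)).injective p
  refine nonsingular_legendre_of_pow_eq_one p hp hodd f (RatFunc.C ζ ^ i.val) RatFunc.X ?_
    RatFunc.X_ne_zero ?_
  · rw [← map_pow, ← map_pow, pow_right_comm, hζ.pow_eq_one, one_pow, map_one]
  · rw [← map_pow]
    exact RatFunc.C_mul_X_add_one_ne_zero _
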